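/- Let Ā, B̄, Q, R be as in the LQR setup with R invertible and symmetric, P a symmetric solution of Āᵀ P + P Ā − P B̄ R⁻¹ B̄ᵀ P + Q = 0, and k = R⁻¹ B̄ᵀ P. Let x : [0,∞) → ℝᴺ be differentiable with ẋ(t) = (Ā − B̄k) x(t) and suppose x(t)ᵀ P x(t) → 0 as t → ∞. Then with the feedback control u(t) = −k x(t), the cost satisfies ∫₀^∞ ( x(t)ᵀ Q x(t) + u(t)ᵀ R u(t) ) dt = x(0)ᵀ P x(0). -/

import Mathlib

open Matrix Filter intervalIntegral

/-- Product rule for a matrix quadratic form along a differentiable curve. -/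
theorem hasDerivAt_dotProduct_mulVec {n : Type*} [Fintype n] (P : Matrix n n ℝ)
    {x : ℝ → n → ℝ} {x' : n → ℝ} {t : ℝ} (hx : HasDerivAt x x' t) :
    HasDerivAt (fun s => x s ⬝ᵥ P *ᵥ x s) (x' ⬝ᵥ P *ᵥ x t + x t ⬝ᵥ P *ᵥ x') t := by
  have hPx : HasDerivAt (fun s => P *ᵥ x s) (P *ᵥ x') t :=
    (P.mulVecLin.toContinuousLinearMap.hasFDerivAt (x := x t)).comp_hasDerivAt t hx
  simp only [dotProduct, ← Finset.sum_add_distrib]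
  exact HasDerivAt.fun_sum fun i _ => (hasDerivAt_pi.1 hx i).mul (hasDerivAt_pi.1 hPx i)

/-- The algebraic Riccati equation rewritten as a Lyapunov equation for the closed loop. -/
theorem riccati_closedLoop_lyapunov {n m : Type*} [Fintype n] [Fintype m] [DecidableEq m]
    {A Q P : Matrix n n ℝ} {B : Matrix n m ℝ} {R : Matrix m m ℝ} {k : Matrix m n ℝ}
    (hRinv : IsUnit R.det) (hRsymm : R.IsSymm) (hPsymm : P.IsSymm)
    (hRic : Aᵀ * P + P * A - P * B * R⁻¹ * Bᵀ * P + Q = 0) (hk : k = R⁻¹ * Bᵀ * P) :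
    (A - B * k)ᵀ * P + P * (A - B * k) = -(Q + kᵀ * R * k) := by
  have hkT : kᵀ = P * B * R⁻¹ := by
    rw [hk, transpose_mul, transpose_mul, transpose_transpose, transpose_nonsing_inv, hRsymm.eq,
      hPsymm.eq, Matrix.mul_assoc]
  have hkR : kᵀ * R = P * B := by
    rw [hkT, Matrix.mul_assoc, nonsing_inv_mul R hRinv, Matrix.mul_one]
  have hPBk : P * (B * k) = P * B * R⁻¹ * Bᵀ * P := by
    rw [hk]; simp only [Matrix.mul_assoc]
  have hkBP : kᵀ * Bᵀ * P = P * B * R⁻¹ * Bᵀ * P := by rw [hkT]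
  rw [transpose_sub, transpose_mul, Matrix.sub_mul, Matrix.mul_sub, hkBP, hPBk, hkR,
    Matrix.mul_assoc P B k, hPBk, ← sub_eq_zero, ← hRic]
  abel

/-- with `R` invertible and symmetric, `P` a symmetric solution of the
ARE, `k = R⁻¹B̄ᵀP`, and a closed-loop trajectory `ẋ = (Ā − B̄k)x` (for `t ≥ 0`)
along which `x(t)ᵀPx(t) → 0`, the feedback `u = −kx` achieves cost
`∫₀^∞ (xᵀQx + uᵀRu) dt = x(0)ᵀPx(0)` (as an improper integral, i.e. the limit of
`∫₀^T` as `T → ∞`). -/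
theorem stmt_8 (N m : ℕ)
    (A : Matrix (Fin N) (Fin N) ℝ)
    (B : Matrix (Fin N) (Fin m) ℝ)
    (Q : Matrix (Fin N) (Fin N) ℝ)
    (R : Matrix (Fin m) (Fin m) ℝ) (hRinv : IsUnit R.det) (hRsymm : R.IsSymm)
    (P : Matrix (Fin N) (Fin N) ℝ) (hPsymm : P.IsSymm)
    (hRic : Aᵀ * P + P * A - P * B * R⁻¹ * Bᵀ * P + Q = 0)
    (k : Matrix (Fin m) (Fin N) ℝ) (hk : k = R⁻¹ * Bᵀ * P)
    (x : ℝ → Fin N → ℝ)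
    (hx : ∀ t : ℝ, 0 ≤ t → HasDerivAt x ((A - B * k).mulVec (x t)) t)
    (hlim : Tendsto (fun t => x t ⬝ᵥ P.mulVec (x t)) atTop (nhds 0))
    (u : ℝ → Fin m → ℝ) (hu : ∀ t, u t = -(k.mulVec (x t))) :
    Tendsto (fun T : ℝ =>
        ∫ t in (0 : ℝ)..T, (x t ⬝ᵥ Q.mulVec (x t) + u t ⬝ᵥ R.mulVec (u t)))
      atTop (nhds (x 0 ⬝ᵥ P.mulVec (x 0))) := by
  have hlyap := riccati_closedLoop_lyapunov hRinv hRsymm hPsymm hRic hk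
  have hderiv : ∀ t : ℝ, 0 ≤ t → HasDerivAt (fun s => x s ⬝ᵥ P *ᵥ x s)
      (-(x t ⬝ᵥ Q *ᵥ x t + u t ⬝ᵥ R *ᵥ u t)) t := by
    intro t ht
    convert hasDerivAt_dotProduct_mulVec P (hx t ht) using 1
    have h := congrArg (fun M => x t ⬝ᵥ M *ᵥ x t) hlyap
    simp only [add_mulVec, neg_mulVec, dotProduct_add, dotProduct_neg, ← mulVec_mulVec,
      dotProduct_mulVec _ (_ᵀ), vecMul_transpose] at h
    simp only [hu, mulVec_neg, dotProduct_neg, neg_dotProduct, neg_neg]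
    exact h.symm
  have hcont : ContinuousOn x (Set.Ici 0) := fun t ht =>
    (hx t ht).continuousAt.continuousWithinAt
  have hint : ∀ T : ℝ, 0 ≤ T →
      ∫ t in (0 : ℝ)..T, (x t ⬝ᵥ Q *ᵥ x t + u t ⬝ᵥ R *ᵥ u t)
        = x 0 ⬝ᵥ P *ᵥ x 0 - x T ⬝ᵥ P *ᵥ x T := by
    intro T hT
    have hsub : Set.uIcc 0 T ⊆ Set.Ici 0 := by
      rw [Set.uIcc_of_le hT]
      exact Set.Icc_subset_Ici_self
    have hx' := hcont.mono hsub
    have hcost : ContinuousOn (fun t => x t ⬝ᵥ Q *ᵥ x t + u t ⬝ᵥ R *ᵥ u t) (Set.uIcc 0 T) := by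
      have hg : Continuous fun y : Fin N → ℝ =>
          y ⬝ᵥ Q *ᵥ y + (-(k *ᵥ y)) ⬝ᵥ R *ᵥ (-(k *ᵥ y)) := by fun_prop
      simp only [hu]
      exact hg.comp_continuousOn hx'
    have h := integral_eq_sub_of_hasDerivAt (fun t ht => hderiv t (hsub ht))
      hcost.neg.intervalIntegrable
    rw [integral_neg] at h
    linarith
  have hsub := hlim.const_sub (x 0 ⬝ᵥ P *ᵥ x 0)
  rw [sub_zero] at hsub
  exact hsub.congr' ((eventually_ge_atTop 0).mono fun T hT => (hint T hT).symm)
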